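/- Let d ∈ {2,3} and let Ω ⊂ ℝ^d be a bounded open set. There exists a constant C₄ = C₄(Ω) such that for every continuously differentiable vector field u : ℝ^d → ℝ^d and all continuously differentiable scalar functions T, S : ℝ^d → ℝ, all with compact support contained in Ω, |b*(u,T,S)| ≤ C₄ √(‖u‖ ‖∇u‖) ‖∇T‖ ‖∇S‖. -/

import Mathlib

open MeasureTheory

noncomputable section

/-- Partial derivative `∂_j f_i` at `x` of a vector field `f : ℝ^d → ℝ^d`. -/
def pd {d : ℕ} (f : (Fin d → ℝ) → (Fin d → ℝ)) (x : Fin d → ℝ) (j i : Fin d) : ℝ :=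
  fderiv ℝ f x (Pi.single j (1 : ℝ)) i

/-- Partial derivative `∂_j f` at `x` of a scalar function `f : ℝ^d → ℝ`. -/
def pdS {d : ℕ} (f : (Fin d → ℝ) → ℝ) (x : Fin d → ℝ) (j : Fin d) : ℝ :=
  fderiv ℝ f x (Pi.single j (1 : ℝ))

/-- Convective term `(u·∇v)_i` at `x`. -/
def conv {d : ℕ} (u v : (Fin d → ℝ) → (Fin d → ℝ)) (x : Fin d → ℝ) (i : Fin d) : ℝ :=
  ∑ j, u x j * pd v x j i

/-- Convective term `u·∇T` at `x` for a scalar `T`. -/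
def convS {d : ℕ} (u : (Fin d → ℝ) → (Fin d → ℝ)) (T : (Fin d → ℝ) → ℝ)
    (x : Fin d → ℝ) : ℝ :=
  ∑ j, u x j * pdS T x j

/-- Divergence `∇·u` at `x`. -/
def divg {d : ℕ} (u : (Fin d → ℝ) → (Fin d → ℝ)) (x : Fin d → ℝ) : ℝ :=
  ∑ j, pd u x j j

/-- Euclidean dot product on `ℝ^d`. -/
def dotv {d : ℕ} (a b : Fin d → ℝ) : ℝ := ∑ i, a i * b i

/-- `L²` norm of a vector field. -/
def l2norm {d : ℕ} (f : (Fin d → ℝ) → (Fin d → ℝ)) : ℝ :=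
  (∫ x, ∑ i, (f x i) ^ 2) ^ (1 / 2 : ℝ)

/-- `L²` norm of the Jacobian matrix of a vector field. -/
def gradNorm {d : ℕ} (f : (Fin d → ℝ) → (Fin d → ℝ)) : ℝ :=
  (∫ x, ∑ i, ∑ j, (pd f x j i) ^ 2) ^ (1 / 2 : ℝ)

/-- `L²` norm of a scalar function. -/
def l2normS {d : ℕ} (f : (Fin d → ℝ) → ℝ) : ℝ :=
  (∫ x, (f x) ^ 2) ^ (1 / 2 : ℝ)

/-- `L²` norm of the gradient of a scalar function. -/
def gradNormS {d : ℕ} (f : (Fin d → ℝ) → ℝ) : ℝ :=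
  (∫ x, ∑ j, (pdS f x j) ^ 2) ^ (1 / 2 : ℝ)

/-- `L^p` norm of a scalar function. -/
def lpnormS {d : ℕ} (p : ℝ) (f : (Fin d → ℝ) → ℝ) : ℝ :=
  (∫ x, |f x| ^ p) ^ (1 / p)

/-- The explicitly skew-symmetric trilinear form
`b(u,v,w) = ½(u·∇v, w) − ½(u·∇w, v)`. -/
def bform {d : ℕ} (u v w : (Fin d → ℝ) → (Fin d → ℝ)) : ℝ :=
  (1 / 2) * (∫ x, dotv (conv u v x) (w x)) - (1 / 2) * (∫ x, dotv (conv u w x) (v x))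

/-- The explicitly skew-symmetric trilinear form
`b*(u,T,S) = ½(u·∇T, S) − ½(u·∇S, T)`. -/
def bstar {d : ℕ} (u : (Fin d → ℝ) → (Fin d → ℝ)) (T S : (Fin d → ℝ) → ℝ) : ℝ :=
  (1 / 2) * (∫ x, convS u T x * S x) - (1 / 2) * (∫ x, convS u S x * T x)

open scoped ENNReal NNReal

lemma aux_holder {α F G : Type*} [MeasurableSpace α] {μ : Measure α} [NormedAddCommGroup F]
    [NormedAddCommGroup G] {u : α → F} {g : α → G} {s : α → ℝ}
    (hu : AEStronglyMeasurable u μ) (hg : AEStronglyMeasurable g μ)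
    (hs : AEStronglyMeasurable s μ) :
    ∫⁻ x, ‖u x‖ₑ * ‖g x‖ₑ * ‖s x‖ₑ ∂μ ≤
      eLpNorm u 2 μ ^ (1/2 : ℝ) * eLpNorm u 6 μ ^ (1/2 : ℝ) * eLpNorm g 2 μ * eLpNorm s 6 μ := by
  have h := ENNReal.lintegral_prod_norm_pow_le (μ := μ) (Finset.univ : Finset (Fin 4))
    (f := ![fun x => ‖u x‖ₑ ^ (2:ℝ), fun x => ‖u x‖ₑ ^ (6:ℝ), fun x => ‖g x‖ₑ ^ (2:ℝ),
      fun x => ‖s x‖ₑ ^ (6:ℝ)]) (p := ![1/4, 1/12, 1/2, 1/6])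
    (by
      intro i _
      fin_cases i
      · exact hu.enorm.pow_const _
      · exact hu.enorm.pow_const _
      · exact hg.enorm.pow_const _
      · exact hs.enorm.pow_const _)
    (by simp [Fin.sum_univ_four]; norm_num)
    (by intro i _; fin_cases i <;> simp)
  simp only [Fin.prod_univ_four, Matrix.cons_val] at h
  have e2 : ∀ {H : Type _} [NormedAddCommGroup H] (f : α → H),
      eLpNorm f 2 μ = (∫⁻ x, ‖f x‖ₑ ^ (2:ℝ) ∂μ) ^ (1/2:ℝ) := by
    intro H _ f
    rw [eLpNorm_eq_lintegral_rpow_enorm_toReal (by norm_num) (by norm_num)]; simp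
  have e6 : ∀ {H : Type _} [NormedAddCommGroup H] (f : α → H),
      eLpNorm f 6 μ = (∫⁻ x, ‖f x‖ₑ ^ (6:ℝ) ∂μ) ^ (1/6:ℝ) := by
    intro H _ f
    rw [eLpNorm_eq_lintegral_rpow_enorm_toReal (by norm_num) (by norm_num)]; simp
  have e2' : eLpNorm g 2 μ = (∫⁻ x, ‖g x‖ₑ ^ (2:ℝ) ∂μ) ^ (1/2:ℝ) := by
    rw [eLpNorm_eq_lintegral_rpow_enorm_toReal (by norm_num) (by norm_num)]; simp
  have e6' : eLpNorm s 6 μ = (∫⁻ x, ‖s x‖ₑ ^ (6:ℝ) ∂μ) ^ (1/6:ℝ) := by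
    rw [eLpNorm_eq_lintegral_rpow_enorm_toReal (by norm_num) (by norm_num)]; simp
  rw [e2 u, e6 u, e2', e6', ← ENNReal.rpow_mul, ← ENNReal.rpow_mul]
  refine le_trans (le_of_eq ?_) (h.trans (le_of_eq ?_))
  · refine lintegral_congr fun x => ?_
    simp only [← ENNReal.rpow_mul]
    rw [← ENNReal.rpow_add_of_nonneg _ _ (by norm_num) (by norm_num)]
    norm_num
  · norm_num

lemma aux_sobolev {d : ℕ} (hd : d = 2 ∨ d = 3) (Ω : Set (Fin d → ℝ)) (hΩo : IsOpen Ω)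
    (hΩb : Bornology.IsBounded Ω) (F : Type*) [NormedAddCommGroup F] [NormedSpace ℝ F]
    [FiniteDimensional ℝ F] :
    ∃ C : ℝ≥0, ∀ f : (Fin d → ℝ) → F, ContDiff ℝ 1 f → tsupport f ⊆ Ω →
      eLpNorm f 6 volume ≤ C * eLpNorm (fderiv ℝ f) 2 volume := by
  rcases hd with rfl | rfl
  · have hfin : (volume Ω) ^ (1/6 : ℝ) ≠ ∞ :=
      ENNReal.rpow_ne_top_of_nonneg (by norm_num) hΩb.measure_lt_top.ne
    refine ⟨eLpNormLESNormFDerivOfLeConst F volume Ω (3/2) 6 * ((volume Ω) ^ (1/6 : ℝ)).toNNReal,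
      fun f hf hs => ?_⟩
    have h := eLpNorm_le_eLpNorm_fderiv_of_le (volume : Measure (Fin 2 → ℝ)) (s := Ω) (p := 3/2)
      (q := 6) hf ((subset_tsupport f).trans hs)
      (by rw [← NNReal.coe_le_coe]; norm_num) (by rw [← NNReal.coe_lt_coe]; norm_num) (by norm_num) hΩb
    have hsup : Function.support (fderiv ℝ f) ⊆ Ω := (support_fderiv_subset ℝ).trans hs
    have h2 := eLpNorm_le_eLpNorm_mul_rpow_measure_univ (μ := volume.restrict Ω)
      (p := ((3/2 : ℝ≥0) : ℝ≥0∞)) (q := ((2 : ℝ≥0) : ℝ≥0∞))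
      (by rw [ENNReal.coe_le_coe, ← NNReal.coe_le_coe]; norm_num)
      ((hf.continuous_fderiv one_ne_zero).aestronglyMeasurable (μ := volume.restrict Ω))
    have hr : ∀ p : ℝ≥0∞, eLpNorm (fderiv ℝ f) p (volume.restrict Ω)
        = eLpNorm (fderiv ℝ f) p volume :=
      fun p => eLpNorm_restrict_eq_of_support_subset (f := fderiv ℝ f) (s := Ω) hsup
    rw [hr, hr] at h2
    simp only [Measure.restrict_apply_univ, ENNReal.coe_toReal] at h2
    norm_num at h2
    refine le_trans h ?_
    rw [ENNReal.coe_mul, ENNReal.coe_toNNReal hfin, mul_assoc]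
    gcongr
    have h32 : ((3/2 : ℝ≥0) : ℝ≥0∞) = 3/2 := by
      rw [ENNReal.coe_div (by norm_num)]; norm_num
    rw [mul_comm, h32]
    exact h2
  · refine ⟨eLpNormLESNormFDerivOfLeConst F volume Ω 2 6, fun f hf hs => ?_⟩
    exact eLpNorm_le_eLpNorm_fderiv_of_le (volume : Measure (Fin 3 → ℝ)) (s := Ω) (p := 2)
      (q := 6) hf ((subset_tsupport f).trans hs)
      (by norm_num) (by norm_num) (by norm_num) hΩb

lemma aux_l2 {α F : Type*} [MeasurableSpace α] {μ : Measure α} [NormedAddCommGroup F]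
    {g : α → F} {h : α → ℝ} (hi : Integrable h μ) (hgh : ∀ x, ‖g x‖ ^ 2 ≤ h x) :
    eLpNorm g 2 μ ≤ ENNReal.ofReal ((∫ x, h x ∂μ) ^ (1/2 : ℝ)) := by
  have h0 : ∀ x, 0 ≤ h x := fun x => (sq_nonneg _).trans (hgh x)
  rw [eLpNorm_eq_lintegral_rpow_enorm_toReal (by norm_num) (by norm_num),
    ← ENNReal.ofReal_rpow_of_nonneg (integral_nonneg h0) (by norm_num),
    ofReal_integral_eq_lintegral_ofReal hi (Filter.Eventually.of_forall h0)]
  simp only [ENNReal.toReal_ofNat]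
  gcongr with x
  rw [← ofReal_norm, ENNReal.ofReal_rpow_of_nonneg (norm_nonneg _) (by norm_num)]
  exact ENNReal.ofReal_le_ofReal (by exact_mod_cast hgh x)

lemma aux_opnorm {d : ℕ} {F : Type*} [NormedAddCommGroup F] [NormedSpace ℝ F]
    (L : (Fin d → ℝ) →L[ℝ] F) :
    ‖L‖ ^ 2 ≤ d * ∑ j, ‖L (Pi.single j 1)‖ ^ 2 := by
  have h1 : ‖L‖ ≤ ∑ j, ‖L (Pi.single j 1)‖ := by
    refine L.opNorm_le_bound (Finset.sum_nonneg fun _ _ => norm_nonneg _) fun x => ?_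
    have hx : L x = ∑ j, x j • L (Pi.single j 1) := by
      conv_lhs => rw [pi_eq_sum_univ' x]
      rw [map_sum]
      refine Finset.sum_congr rfl fun j _ => ?_
      rw [map_smul]
    rw [hx, Finset.sum_mul]
    refine (norm_sum_le _ _).trans (Finset.sum_le_sum fun j _ => ?_)
    rw [norm_smul, mul_comm]
    gcongr
    exact norm_le_pi_norm x j
  calc ‖L‖ ^ 2 ≤ (∑ j, ‖L (Pi.single j 1)‖) ^ 2 := by gcongr
    _ ≤ _ := by simpa using sq_sum_le_card_mul_sum_sq (s := Finset.univ) (f := fun j => ‖L (Pi.single j 1)‖)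

lemma aux_pinorm {d : ℕ} (v : Fin d → ℝ) : ‖v‖ ^ 2 ≤ ∑ i, v i ^ 2 := by
  have h0 : 0 ≤ ∑ i, v i ^ 2 := Finset.sum_nonneg fun _ _ => sq_nonneg _
  have h1 : ‖v‖ ≤ Real.sqrt (∑ i, v i ^ 2) := by
    rw [pi_norm_le_iff_of_nonneg (Real.sqrt_nonneg _)]
    intro i
    rw [Real.norm_eq_abs]
    exact Real.abs_le_sqrt (Finset.single_le_sum (f := fun i => v i ^ 2)
      (fun _ _ => sq_nonneg _) (Finset.mem_univ i))
  calc ‖v‖ ^ 2 ≤ Real.sqrt (∑ i, v i ^ 2) ^ 2 := by gcongr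
    _ = _ := Real.sq_sqrt h0

lemma aux_convS {d : ℕ} (u : (Fin d → ℝ) → (Fin d → ℝ)) (T : (Fin d → ℝ) → ℝ) (x : Fin d → ℝ) :
    ‖convS u T x‖ ≤ ‖u x‖ * ‖fderiv ℝ T x‖ := by
  have : convS u T x = fderiv ℝ T x (u x) := by
    conv_rhs => rw [pi_eq_sum_univ' (u x)]
    rw [map_sum]
    refine Finset.sum_congr rfl fun j _ => ?_
    rw [map_smul, smul_eq_mul, pdS]
  rw [this, mul_comm]
  exact ContinuousLinearMap.le_opNorm _ _

lemma aux_grad {d : ℕ} {u : (Fin d → ℝ) → (Fin d → ℝ)} (hu : ContDiff ℝ 1 u)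
    (hc : HasCompactSupport u) :
    eLpNorm (fderiv ℝ u) 2 volume ≤ ENNReal.ofReal ((d : ℝ) ^ (1/2 : ℝ) * gradNorm u) := by
  have hcont : Continuous (fderiv ℝ u) := hu.continuous_fderiv one_ne_zero
  have hi : Integrable (fun x => ∑ i, ∑ j, (pd u x j i) ^ 2) := by
    refine Continuous.integrable_of_hasCompactSupport (by unfold pd; fun_prop) ?_
    refine (hc.fderiv ℝ).mono ?_
    intro x hx hx0
    apply hx
    simp only [pd]
    simp [hx0]
  have h := aux_l2 (g := fderiv ℝ u) (hi.const_mul (d : ℝ)) (fun x => by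
    refine (aux_opnorm _).trans ?_
    rw [Finset.sum_comm]
    gcongr
    exact aux_pinorm _)
  rw [integral_const_mul, Real.mul_rpow (by positivity)
    (integral_nonneg fun x => by positivity)] at h
  exact h

lemma aux_gradS {d : ℕ} {u : (Fin d → ℝ) → ℝ} (hu : ContDiff ℝ 1 u)
    (hc : HasCompactSupport u) :
    eLpNorm (fderiv ℝ u) 2 volume ≤ ENNReal.ofReal ((d : ℝ) ^ (1/2 : ℝ) * gradNormS u) := by
  have hcont : Continuous (fderiv ℝ u) := hu.continuous_fderiv one_ne_zero
  have hi : Integrable (fun x => ∑ j, (pdS u x j) ^ 2) := by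
    refine Continuous.integrable_of_hasCompactSupport (by unfold pdS; fun_prop) ?_
    refine (hc.fderiv ℝ).mono ?_
    intro x hx hx0
    apply hx
    simp only [pdS]
    simp [hx0]
  have h := aux_l2 (g := fderiv ℝ u) (hi.const_mul (d : ℝ)) (fun x => by
    refine (aux_opnorm _).trans ?_
    simp only [Real.norm_eq_abs, sq_abs, pdS, le_refl])
  rw [integral_const_mul, Real.mul_rpow (by positivity)
    (integral_nonneg fun x => by positivity)] at h
  exact h

lemma aux_l2u {d : ℕ} {u : (Fin d → ℝ) → (Fin d → ℝ)} (hu : ContDiff ℝ 1 u)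
    (hc : HasCompactSupport u) :
    eLpNorm u 2 volume ≤ ENNReal.ofReal (l2norm u) := by
  have hcont : Continuous u := hu.continuous
  have hi : Integrable (fun x => ∑ j, (u x j) ^ 2) := by
    refine Continuous.integrable_of_hasCompactSupport (by fun_prop) ?_
    refine hc.mono ?_
    intro x hx hx0
    apply hx
    simp [hx0]
  exact aux_l2 hi (fun x => aux_pinorm _)

lemma aux_half {d : ℕ} {C₁ C₂ : ℝ≥0} {u : (Fin d → ℝ) → (Fin d → ℝ)} {T S : (Fin d → ℝ) → ℝ}
    (hu : ContDiff ℝ 1 u) (hT : ContDiff ℝ 1 T) (hS : ContDiff ℝ 1 S)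
    (hcu : HasCompactSupport u) (hcT : HasCompactSupport T) (hcS : HasCompactSupport S)
    (h1 : eLpNorm u 6 volume ≤ C₁ * eLpNorm (fderiv ℝ u) 2 volume)
    (h2 : eLpNorm S 6 volume ≤ C₂ * eLpNorm (fderiv ℝ S) 2 volume) :
    |∫ x, convS u T x * S x| ≤ (l2norm u) ^ (1/2 : ℝ) *
      (C₁ * ((d : ℝ) ^ (1/2 : ℝ) * gradNorm u)) ^ (1/2 : ℝ) *
      ((d : ℝ) ^ (1/2 : ℝ) * gradNormS T) * (C₂ * ((d : ℝ) ^ (1/2 : ℝ) * gradNormS S)) := by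
  have n1 : 0 ≤ l2norm u := Real.rpow_nonneg (integral_nonneg fun x => by positivity) _
  have n2 : 0 ≤ gradNorm u := Real.rpow_nonneg (integral_nonneg fun x => by positivity) _
  have n3 : 0 ≤ gradNormS T := Real.rpow_nonneg (integral_nonneg fun x => by positivity) _
  have n4 : 0 ≤ gradNormS S := Real.rpow_nonneg (integral_nonneg fun x => by positivity) _
  have k1 : eLpNorm u 6 volume ≤ ENNReal.ofReal (C₁ * ((d : ℝ) ^ (1/2 : ℝ) * gradNorm u)) := by
    rw [ENNReal.ofReal_mul (by positivity), ENNReal.ofReal_coe_nnreal]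
    refine h1.trans ?_
    gcongr
    exact aux_grad hu hcu
  have k2 : eLpNorm S 6 volume ≤ ENNReal.ofReal (C₂ * ((d : ℝ) ^ (1/2 : ℝ) * gradNormS S)) := by
    rw [ENNReal.ofReal_mul (by positivity), ENNReal.ofReal_coe_nnreal]
    refine h2.trans ?_
    gcongr
    exact aux_gradS hS hcS
  rw [← Real.norm_eq_abs, ← ENNReal.ofReal_le_ofReal_iff (by positivity), ofReal_norm]
  refine (enorm_integral_le_lintegral_enorm _).trans ?_
  calc ∫⁻ x, ‖convS u T x * S x‖ₑ ≤ ∫⁻ x, ‖u x‖ₑ * ‖fderiv ℝ T x‖ₑ * ‖S x‖ₑ := by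
        refine lintegral_mono fun x => ?_
        rw [enorm_mul]
        gcongr
        simp only [← ofReal_norm]
        rw [← ENNReal.ofReal_mul (norm_nonneg _)]
        exact ENNReal.ofReal_le_ofReal (aux_convS u T x)
    _ ≤ _ := aux_holder hu.continuous.aestronglyMeasurable
        (hT.continuous_fderiv one_ne_zero).aestronglyMeasurable
        hS.continuous.aestronglyMeasurable
    _ ≤ _ := by
        rw [ENNReal.ofReal_mul (by positivity), ENNReal.ofReal_mul (by positivity),
          ENNReal.ofReal_mul (by positivity),
          ← ENNReal.ofReal_rpow_of_nonneg (by positivity) (by norm_num),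
          ← ENNReal.ofReal_rpow_of_nonneg (by positivity) (by norm_num)]
        gcongr
        · exact aux_l2u hu hcu
        · exact aux_gradS hT hcT

/-- For `d ∈ {2,3}` and a bounded open `Ω ⊂ ℝ^d`, there is `C₄ = C₄(Ω)`
such that for every C¹ vector field `u` and C¹ scalars `T, S`, all with compact
support in `Ω`, `|b*(u,T,S)| ≤ C₄ √(‖u‖ ‖∇u‖) ‖∇T‖ ‖∇S‖`. -/
theorem statement5 {d : ℕ} (hd : d = 2 ∨ d = 3)
    (Ω : Set (Fin d → ℝ)) (hΩo : IsOpen Ω) (hΩb : Bornology.IsBounded Ω) :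
    ∃ C₄ : ℝ, ∀ (u : (Fin d → ℝ) → (Fin d → ℝ)) (T S : (Fin d → ℝ) → ℝ),
      ContDiff ℝ 1 u → ContDiff ℝ 1 T → ContDiff ℝ 1 S →
      HasCompactSupport u → HasCompactSupport T → HasCompactSupport S →
      tsupport u ⊆ Ω → tsupport T ⊆ Ω → tsupport S ⊆ Ω →
      |bstar u T S| ≤ C₄ * Real.sqrt (l2norm u * gradNorm u) * gradNormS T * gradNormS S := by
  obtain ⟨C₁, hC₁⟩ := aux_sobolev hd Ω hΩo hΩb (Fin d → ℝ)
  obtain ⟨C₂, hC₂⟩ := aux_sobolev hd Ω hΩo hΩb ℝ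
  refine ⟨(C₁ * (d : ℝ) ^ (1/2 : ℝ)) ^ (1/2 : ℝ) * (d : ℝ) ^ (1/2 : ℝ) * C₂ *
    (d : ℝ) ^ (1/2 : ℝ), ?_⟩
  intro u T S hu hT hS hcu hcT hcS hsu hsT hsS
  have e1 := aux_half hu hT hS hcu hcT hcS (hC₁ u hu hsu) (hC₂ S hS hsS)
  have e2 := aux_half hu hS hT hcu hcS hcT (hC₁ u hu hsu) (hC₂ T hT hsT)
  have n1 : 0 ≤ l2norm u := Real.rpow_nonneg (integral_nonneg fun x => by positivity) _
  have n2 : 0 ≤ gradNorm u := Real.rpow_nonneg (integral_nonneg fun x => by positivity) _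
  rw [← mul_assoc (C₁ : ℝ), Real.mul_rpow (by positivity) n2] at e1 e2
  rw [Real.sqrt_eq_rpow, Real.mul_rpow n1 n2]
  unfold bstar
  rw [abs_le] at e1 e2 ⊢
  constructor <;> linarith [e1.1, e1.2, e2.1, e2.2]
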